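/- arXiv:math/0009047 — 3 statements merged into one kernel-verified Lean document; each statement's English description precedes it below -/
import Mathlib

section
/- For every pattern s and every Z ∈ I, the τ-closure of B_s \ Z equals B_s. -/
open Set TopologicalSpace

/-- `I` is a σ-ideal of subsets of `X`: it contains `∅`, is closed under taking
subsets and under countable unions. -/
def IsSigmaIdeal {X : Type*} (I : Set (Set X)) : Prop :=
  ∅ ∈ I ∧ (∀ S T : Set X, S ⊆ T → T ∈ I → S ∈ I) ∧
    ∀ f : ℕ → Set X, (∀ n, f n ∈ I) → (⋃ n, f n) ∈ I

/-- The set `B_s` associated to the pattern with (finite) domain `D` and values `s`: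
`B_s = ⋂_{α ∈ D} A_α^{s α}` where `A^1 = A` and `A^0 = X \ A`. -/
def patternSet {X J : Type*} (A : J → Set X) (D : Finset J) (s : J → Bool) : Set X :=
  ⋂ α ∈ D, if s α then A α else (A α)ᶜ

/-- Two patterns are contradictory if they disagree at some common point of their domains. -/
def Contradictory {J : Type*} (p q : Finset J × (J → Bool)) : Prop :=
  ∃ α, α ∈ p.1 ∧ α ∈ q.1 ∧ p.2 α ≠ q.2 α

/-- Independence mod `I`: `B_s ∉ I` for every pattern `s`. -/
def IndependentModI {X J : Type*} (I : Set (Set X)) (A : J → Set X) : Prop :=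
  ∀ (D : Finset J) (s : J → Bool), patternSet A D s ∉ I

/-- Decomposition: every `S ⊆ X` agrees mod `I` with a countable union of `B_s`'s for
pairwise contradictory patterns. -/
def Decomposition {X J : Type*} (I : Set (Set X)) (A : J → Set X) : Prop :=
  ∀ S : Set X, ∃ P : Set (Finset J × (J → Bool)), P.Countable ∧
    P.Pairwise Contradictory ∧ symmDiff S (⋃ p ∈ P, patternSet A p.1 p.2) ∈ I

/-- Separation: disjoint members of `I` are separated by some `A_α`. -/
def SeparatesIdeal {X J : Type*} (I : Set (Set X)) (A : J → Set X) : Prop :=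
  ∀ Z ∈ I, ∀ Z' ∈ I, Disjoint Z Z' → ∃ α, Z ⊆ A α ∧ Z' ⊆ (A α)ᶜ

/-- The topology `τ` generated by the subbasis
`{A_α \ Z : α ∈ J, Z ∈ I} ∪ {(X \ A_α) \ Z : α ∈ J, Z ∈ I}`. -/
def idealTopology {X J : Type*} (I : Set (Set X)) (A : J → Set X) : TopologicalSpace X :=
  TopologicalSpace.generateFrom
    ({U | ∃ α, ∃ Z ∈ I, U = A α \ Z} ∪ {U | ∃ α, ∃ Z ∈ I, U = (A α)ᶜ \ Z})

theorem mem_patternSet {X J : Type*} {A : J → Set X} {D : Finset J} {s : J → Bool} {x : X} :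
    x ∈ patternSet A D s ↔ ∀ α ∈ D, (x ∈ A α ↔ s α = true) := by
  simp only [patternSet, mem_iInter]
  refine forall₂_congr fun α _ => ?_
  cases s α <;> simp

theorem IsSigmaIdeal.union_mem {X : Type*} {I : Set (Set X)} (hI : IsSigmaIdeal I)
    {S T : Set X} (hS : S ∈ I) (hT : T ∈ I) : S ∪ T ∈ I := by
  refine hI.2.1 _ _ ?_ (hI.2.2 (fun n => if n = 0 then S else T) fun n => ?_)
  · exact union_subset (subset_iUnion_of_subset 0 (by simp))
      (subset_iUnion_of_subset 1 (by simp))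
  · split_ifs <;> assumption

theorem isClosed_patternSet {X J : Type*} {I : Set (Set X)} (A : J → Set X) (hI : ∅ ∈ I)
    (D : Finset J) (s : J → Bool) : @IsClosed X (idealTopology I A) (patternSet A D s) := by
  let _ : TopologicalSpace X := idealTopology I A
  refine isClosed_biInter fun α _ => ?_
  rw [← isOpen_compl_iff]
  refine isOpen_generateFrom_of_mem ?_
  cases s α
  · exact Or.inl ⟨α, ∅, hI, by simp⟩
  · exact Or.inr ⟨α, ∅, hI, by simp⟩

/-- Every neighbourhood of `x` contains, up to a member of the ideal, a pattern set through `x`. -/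
theorem exists_patternSet_diff_subset {X J : Type*} {I : Set (Set X)} {A : J → Set X}
    (hI : IsSigmaIdeal I) {x : X} {s : J → Bool} (hs : ∀ α, x ∈ A α ↔ s α = true)
    {U : Set X} (hU : @IsOpen X (idealTopology I A) U) (hx : x ∈ U) :
    ∃ D : Finset J, ∃ W ∈ I, patternSet A D s \ W ⊆ U := by
  classical
  induction hU with
  | basic U hU =>
    obtain ⟨α, W, hW, rfl⟩ | ⟨α, W, hW, rfl⟩ := hU <;>
      refine ⟨{α}, W, hW, sdiff_subset_sdiff_left fun y hy => ?_⟩ <;>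
      have h := mem_patternSet.1 hy α (Finset.mem_singleton_self α)
    · exact h.2 ((hs α).1 hx.1)
    · exact fun hyA => hx.1 ((hs α).2 (h.1 hyA))
  | univ => exact ⟨∅, ∅, hI.1, subset_univ _⟩
  | inter U V _ _ ihU ihV =>
    obtain ⟨D, W, hW, hD⟩ := ihU hx.1
    obtain ⟨E, W', hW', hE⟩ := ihV hx.2
    refine ⟨D ∪ E, W ∪ W', hI.union_mem hW hW', fun y hy => ?_⟩
    have h := mem_patternSet.1 hy.1
    exact ⟨hD ⟨mem_patternSet.2 fun α hα => h α (Finset.mem_union_left _ hα),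
        fun hyW => hy.2 (Or.inl hyW)⟩,
      hE ⟨mem_patternSet.2 fun α hα => h α (Finset.mem_union_right _ hα),
        fun hyW => hy.2 (Or.inr hyW)⟩⟩
  | sUnion S _ ih =>
    obtain ⟨U, hU, hxU⟩ := hx
    obtain ⟨D, W, hW, hD⟩ := ih U hU hxU
    exact ⟨D, W, hW, hD.trans (subset_sUnion_of_mem hU)⟩

theorem stmt_7 {X J : Type*} (I : Set (Set X)) (A : J → Set X)
    (hI : IsSigmaIdeal I) (hX : (Set.univ : Set X) ∉ I) (hsing : ∀ x : X, ({x} : Set X) ∈ I)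
    (hind : IndependentModI I A) (hdec : Decomposition I A) (hsep : SeparatesIdeal I A)
    (D : Finset J) (s : J → Bool) : ∀ Z ∈ I,
      @closure X (idealTopology I A) (patternSet A D s \ Z) = patternSet A D s := by
  classical
  intro Z hZ
  let _ : TopologicalSpace X := idealTopology I A
  refine (closure_minimal sdiff_subset (isClosed_patternSet A hI.1 D s)).antisymm fun x hx => ?_
  rw [mem_closure_iff]
  intro U hU hxU
  obtain ⟨E, W, hW, hE⟩ := exists_patternSet_diff_subset (A := A) hI
    (s := fun α => decide (x ∈ A α)) (fun α => by simp) hU hxU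
  have hne : ¬ patternSet A (D ∪ E) (fun α => decide (x ∈ A α)) ⊆ Z ∪ W := fun h =>
    hind _ _ (hI.2.1 _ _ h (hI.union_mem hZ hW))
  obtain ⟨y, hy, hyZW⟩ := not_subset.1 hne
  rw [mem_patternSet] at hy hx
  refine ⟨y, hE ⟨mem_patternSet.2 fun α hα => hy α (Finset.mem_union_right _ hα),
    fun h => hyZW (Or.inr h)⟩, mem_patternSet.2 fun α hα => ?_, fun h => hyZW (Or.inl h)⟩
  rw [hy α (Finset.mem_union_left _ hα), decide_eq_true_iff, hx α hα]
end

section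
/- The space (X, τ) is non-meager in itself: X is not a countable union of sets whose τ-closure has empty τ-interior. -/
open Set TopologicalSpace

theorem isOpen_patternSet_diff {X J : Type*} {I : Set (Set X)} (A : J → Set X)
    (hempty : ∅ ∈ I) [Nonempty J] (D : Finset J) (s : J → Bool) {Z : Set X} (hZ : Z ∈ I) :
    @IsOpen X (idealTopology I A) (patternSet A D s \ Z) := by
  let _ := idealTopology I A
  have hpos : ∀ α, ∀ Z ∈ I, IsOpen (A α \ Z) := fun α Z hZ =>
    isOpen_generateFrom_of_mem (Or.inl ⟨α, Z, hZ, rfl⟩)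
  have hneg : ∀ α, ∀ Z ∈ I, IsOpen ((A α)ᶜ \ Z) := fun α Z hZ =>
    isOpen_generateFrom_of_mem (Or.inr ⟨α, Z, hZ, rfl⟩)
  have hcompl : IsOpen Zᶜ := by
    obtain ⟨α⟩ := ‹Nonempty J›
    have h := (hpos α Z hZ).union (hneg α Z hZ)
    rwa [← union_sdiff_distrib, union_compl_self, ← compl_eq_univ_sdiff] at h
  rw [sdiff_eq]
  refine IsOpen.inter (isOpen_biInter_finset fun α _ => ?_) hcompl
  split_ifs
  · simpa using hpos α ∅ hempty
  · simpa using hneg α ∅ hempty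

theorem mem_of_interior_eq_empty {X J : Type*} {I : Set (Set X)} {A : J → Set X}
    (hI : IsSigmaIdeal I) [Nonempty J] (hind : IndependentModI I A) (hdec : Decomposition I A)
    {S : Set X} (hS : @interior X (idealTopology I A) S = ∅) : S ∈ I := by
  let _ := idealTopology I A
  obtain ⟨P, -, -, hP⟩ := hdec S
  rcases P.eq_empty_or_nonempty with rfl | ⟨p, hp⟩
  · rwa [biUnion_empty, ← bot_eq_empty, symmDiff_bot] at hP
  · have hZ : patternSet A p.1 p.2 \ S ∈ I :=
      hI.2.1 _ _ (fun x hx => Or.inr ⟨mem_biUnion hp hx.1, hx.2⟩) hP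
    have hsub : patternSet A p.1 p.2 \ (patternSet A p.1 p.2 \ S) ⊆ S :=
      fun x hx => by_contra fun h => hx.2 ⟨hx.1, h⟩
    have hint := interior_maximal hsub (isOpen_patternSet_diff A hI.1 p.1 p.2 hZ)
    rw [hS, subset_empty_iff, sdiff_eq_empty] at hint
    exact absurd (hI.2.1 _ _ hint hZ) (hind p.1 p.2)

theorem IsSigmaIdeal.sUnion_mem {X : Type*} {I : Set (Set X)} (hI : IsSigmaIdeal I)
    {C : Set (Set X)} (hC : C.Countable) (h : C ⊆ I) : ⋃₀ C ∈ I := by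
  rcases C.eq_empty_or_nonempty with rfl | hne
  · simpa using hI.1
  · obtain ⟨f, rfl⟩ := hC.exists_eq_range hne
    rw [sUnion_range]
    exact hI.2.2 f fun n => h (mem_range_self n)

theorem stmt_11 {X J : Type*} (I : Set (Set X)) (A : J → Set X)
    (hI : IsSigmaIdeal I) (hX : (Set.univ : Set X) ∉ I) (hsing : ∀ x : X, ({x} : Set X) ∈ I)
    (hind : IndependentModI I A) (hdec : Decomposition I A) (hsep : SeparatesIdeal I A)
    : ¬ @IsMeagre X (idealTopology I A) (Set.univ : Set X) := by
  let _ := idealTopology I A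
  intro hmeagre
  obtain ⟨α, -⟩ := hsep ∅ hI.1 ∅ hI.1 (disjoint_empty _)
  have : Nonempty J := ⟨α⟩
  obtain ⟨C, hnd, hC, hcover⟩ := isMeagre_iff_countable_union_isNowhereDense.mp hmeagre
  have hCI : C ⊆ I := fun S hS =>
    hI.2.1 _ _ subset_closure (mem_of_interior_eq_empty hI hind hdec (hnd S hS))
  exact hX (hI.2.1 _ _ hcover (hI.sUnion_mem hC hCI))
end

section
/- Every subset of X belongs to the Borel σ-algebra of the space (X, τ), i.e., the σ-algebra generated by the τ-open sets. -/
open Set TopologicalSpace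

theorem isOpen_compl_of_mem_ideal {X J : Type*} {I : Set (Set X)} {A : J → Set X} (α : J)
    {Z : Set X} (hZ : Z ∈ I) : @IsOpen X (idealTopology I A) Zᶜ := by
  let _ := idealTopology I A
  have h₁ : IsOpen (A α \ Z) := isOpen_generateFrom_of_mem (Or.inl ⟨α, Z, hZ, rfl⟩)
  have h₂ : IsOpen ((A α)ᶜ \ Z) := isOpen_generateFrom_of_mem (Or.inr ⟨α, Z, hZ, rfl⟩)
  have h : Zᶜ = A α \ Z ∪ (A α)ᶜ \ Z := by
    rw [← union_sdiff_distrib, union_compl_self, compl_eq_univ_sdiff]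
  exact h ▸ h₁.union h₂

theorem isOpen_patternSet {X J : Type*} {I : Set (Set X)} {A : J → Set X} (h : ∅ ∈ I)
    (D : Finset J) (s : J → Bool) : @IsOpen X (idealTopology I A) (patternSet A D s) := by
  let _ := idealTopology I A
  refine isOpen_biInter_finset fun α _ ↦ ?_
  split_ifs
  · exact isOpen_generateFrom_of_mem (Or.inl ⟨α, ∅, h, sdiff_empty.symm⟩)
  · exact isOpen_generateFrom_of_mem (Or.inr ⟨α, ∅, h, sdiff_empty.symm⟩)

theorem stmt_12 {X J : Type*} (I : Set (Set X)) (A : J → Set X)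
    (hI : IsSigmaIdeal I) (hX : (Set.univ : Set X) ∉ I) (hsing : ∀ x : X, ({x} : Set X) ∈ I)
    (hind : IndependentModI I A) (hdec : Decomposition I A) (hsep : SeparatesIdeal I A)
    : ∀ S : Set X, @MeasurableSet X (@borel X (idealTopology I A)) S := by
  intro S
  let _ := idealTopology I A
  let _ : MeasurableSpace X := borel X
  have : BorelSpace X := ⟨rfl⟩
  obtain ⟨α, -⟩ := hsep ∅ hI.1 ∅ hI.1 (disjoint_empty _)
  obtain ⟨P, -, -, hP⟩ := hdec S
  have hU : MeasurableSet (⋃ p ∈ P, patternSet A p.1 p.2) :=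
    (isOpen_biUnion fun p _ ↦ isOpen_patternSet hI.1 p.1 p.2).measurableSet
  have hN := (isOpen_compl_of_mem_ideal (A := A) α hP).measurableSet.of_compl
  exact symmDiff_symmDiff_cancel_right (⋃ p ∈ P, patternSet A p.1 p.2) S ▸ hN.symmDiff hU
end
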